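/- arXiv:2002.01853 — 3 statements merged into one kernel-verified Lean document; each statement's English description precedes it below -/
import Mathlib

section
/- For every a ∈ F_q^*, the cardinality of the defining set satisfies |D_{(a,0)}| = q²/2 + (q/2)·S(a,0) − 1, and for every b ∈ F_q^*, |D_{(a,b)}| = q²/2 − 1. -/
open Finset in
theorem two_mul_card_filter_eq_zero_of_map_add_one {F α : Type*} [Field F] [CharP F 2] [Fintype α]
    [DecidableEq F] (f : α → F) (g : Equiv.Perm α)
    (hf : ∀ p, f p = 0 ∨ f p = 1) (hg : ∀ p, f (g p) = f p + 1) :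
    2 * (univ.filter fun p => f p = 0).card = Fintype.card α := by
  have hcard : (univ.filter fun p => f p = 0).card = (univ.filter fun p => ¬ f p = 0).card := by
    refine card_equiv g fun p => ?_
    simp only [mem_filter, mem_univ, true_and, hg]
    rcases hf p with hp | hp
    · simp [hp]
    · simp [hp, CharTwo.add_self_eq_zero]
  have hsum := card_filter_add_card_filter_not (s := (univ : Finset α)) (fun p => f p = 0)
  rw [card_univ] at hsum
  omega

theorem charP_two_of_card_eq_two_pow {F : Type*} [Field F] [Fintype F] {e : ℕ}
    (hF : Fintype.card F = 2 ^ e) : CharP F 2 := by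
  have hcast : ((2 ^ e : ℕ) : F) = 0 := hF ▸ FiniteField.cast_card_eq_zero F
  push_cast at hcast
  exact CharTwo.of_one_ne_zero_of_two_eq_zero one_ne_zero (pow_eq_zero_iff (n := e) (M₀ := F) (by rintro rfl; simp at hcast) |>.mp hcast)

theorem sum_pow_two_pow_add {F : Type*} [Field F] [CharP F 2] (e : ℕ) (x y : F) :
    ∑ i ∈ Finset.range e, (x + y) ^ 2 ^ i =
      ∑ i ∈ Finset.range e, x ^ 2 ^ i + ∑ i ∈ Finset.range e, y ^ 2 ^ i := by
  simp_rw [add_pow_char_pow, Finset.sum_add_distrib]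

theorem sum_pow_two_pow_eq_zero_or_one {F : Type*} [Field F] [Fintype F] {e : ℕ}
    (hF : Fintype.card F = 2 ^ e) (x : F) :
    ∑ i ∈ Finset.range e, x ^ 2 ^ i = 0 ∨ ∑ i ∈ Finset.range e, x ^ 2 ^ i = 1 := by
  have := charP_two_of_card_eq_two_pow hF
  have hsq : (∑ i ∈ Finset.range e, x ^ 2 ^ i) ^ 2 = ∑ i ∈ Finset.range e, x ^ 2 ^ i := by
    rw [sum_pow_char]
    simp_rw [← pow_mul, ← pow_succ]
    have hx : x ^ 2 ^ e = x := hF ▸ FiniteField.pow_card x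
    have h₁ := Finset.sum_range_succ (fun i => x ^ 2 ^ i) e
    have h₂ := Finset.sum_range_succ' (fun i => x ^ 2 ^ i) e
    rw [h₁, hx, pow_zero, pow_one] at h₂
    exact (add_right_cancel h₂).symm
  have hmul : (∑ i ∈ Finset.range e, x ^ 2 ^ i) * (∑ i ∈ Finset.range e, x ^ 2 ^ i - 1) = 0 := by
    linear_combination hsq
  exact (mul_eq_zero.mp hmul).imp_right sub_eq_zero.mp

open Polynomial in
theorem exists_sum_pow_two_pow_eq_one {F : Type*} [Field F] [Fintype F] {e : ℕ} (he : 0 < e)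
    (hF : Fintype.card F = 2 ^ e) : ∃ x : F, ∑ i ∈ Finset.range e, x ^ 2 ^ i = 1 := by
  by_contra! hne
  have hzero (x : F) : ∑ i ∈ Finset.range e, x ^ 2 ^ i = 0 :=
    (sum_pow_two_pow_eq_zero_or_one hF x).resolve_right (hne x)
  have hdeg : (∑ i ∈ Finset.range e, (X : F[X]) ^ 2 ^ i).natDegree < Fintype.card F := by
    rw [hF]
    refine (natDegree_sum_le_of_forall_le (n := 2 ^ (e - 1)) _ _ fun i hi => ?_).trans_lt
      (Nat.pow_lt_pow_right one_lt_two (by omega))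
    rw [natDegree_X_pow]
    exact Nat.pow_le_pow_right two_pos (by have := Finset.mem_range.mp hi; omega)
  have hP := eq_zero_of_natDegree_lt_card_of_eval_eq_zero
    (∑ i ∈ Finset.range e, (X : F[X]) ^ 2 ^ i) (f := id) Function.injective_id
    (fun x => by simpa [eval_finsetSum] using hzero x) hdeg
  have hcoeff := congrArg (coeff · 1) hP
  simp only [finsetSum_coeff, coeff_X_pow, coeff_zero] at hcoeff
  rw [Finset.sum_eq_single_of_mem 0 (Finset.mem_range.mpr he)] at hcoeff
  · simp at hcoeff
  · intro i _ hi
    have : 1 < 2 ^ i := Nat.one_lt_two_pow hi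
    rw [if_neg this.ne]


/-- Length of the defining set: for `a ∈ F_q^*`, `|D_{(a,0)}| = q²/2 + (q/2)·S(a,0) − 1`,
and for `b ∈ F_q^*`, `|D_{(a,b)}| = q²/2 − 1`. -/
theorem stmt_4
    (e h : ℕ) (hdvd : h ∣ e) (hh0 : 0 < h) (hhe : h < e)
    (F : Type) [Field F] [Fintype F] [DecidableEq F]
    (hF : Fintype.card F = 2 ^ e)
    (q : ℤ) (hq : q = 2 ^ e)
    (Tr : F → F) (hTr : ∀ x, Tr x = ∑ i ∈ Finset.range e, x ^ 2 ^ i)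
    (S : F → F → ℤ)
    (hS : ∀ a b : F, S a b = ∑ x : F,
        if Tr (a * x ^ (2 ^ h + 1) + b * x) = 0 then (1 : ℤ) else -1)
    (D : F → F → Finset (F × F))
    (hD : ∀ a b : F, D a b = Finset.univ.filter fun p : F × F =>
        p ≠ (0, 0) ∧ Tr (a * p.1 ^ (2 ^ h + 1) + b * p.2) = 0)
    (a : F) (ha : a ≠ 0) :
    (((D a 0).card : ℤ) = q ^ 2 / 2 + q / 2 * S a 0 - 1) ∧
    (∀ b : F, b ≠ 0 → ((D a b).card : ℤ) = q ^ 2 / 2 - 1) := by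
  have he : 0 < e := hh0.trans hhe
  have := charP_two_of_card_eq_two_pow hF
  have hcardF : (Fintype.card F : ℤ) = q := by rw [hF, hq]; norm_cast
  obtain ⟨m, hm⟩ : ∃ m : ℤ, q = 2 * m :=
    ⟨2 ^ (e - 1), by rw [hq, ← pow_succ', Nat.sub_add_cancel he]⟩
  have hm2 : q / 2 = m := by omega
  have hsq : q ^ 2 / 2 = q * m := by
    rw [show q ^ 2 = q * m * 2 by rw [hm]; ring, Int.mul_ediv_cancel _ two_ne_zero]
  have hTr0 : Tr 0 = 0 := by simp [hTr]
  have hDcard (b : F) : ((D a b).card : ℤ) = (Finset.univ.filter fun p : F × F =>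
      Tr (a * p.1 ^ (2 ^ h + 1) + b * p.2) = 0).card - 1 := by
    have hmem : ((0, 0) : F × F) ∈ Finset.univ.filter fun p : F × F =>
        Tr (a * p.1 ^ (2 ^ h + 1) + b * p.2) = 0 := by
      simp [hTr0]
    have hDe : D a b = (Finset.univ.filter fun p : F × F =>
        Tr (a * p.1 ^ (2 ^ h + 1) + b * p.2) = 0).erase (0, 0) := by
      ext p
      simp [hD]
    rw [hDe, Finset.cast_card_erase_of_mem hmem]
  refine ⟨?_, fun b hb => ?_⟩
  · have hprod : (Finset.univ.filter fun p : F × F =>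
        Tr (a * p.1 ^ (2 ^ h + 1) + 0 * p.2) = 0) =
        (Finset.univ.filter fun x : F => Tr (a * x ^ (2 ^ h + 1)) = 0) ×ˢ Finset.univ := by
      ext p
      simp
    have hsum := Finset.card_filter_add_card_filter_not (s := (Finset.univ : Finset F))
      (fun x => Tr (a * x ^ (2 ^ h + 1)) = 0)
    have hS0 : S a 0 = (Finset.univ.filter fun x : F => Tr (a * x ^ (2 ^ h + 1)) = 0).card -
        (Finset.univ.filter fun x : F => ¬ Tr (a * x ^ (2 ^ h + 1)) = 0).card := by
      simp [hS, Finset.sum_ite, sub_eq_add_neg]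
    rw [Finset.card_univ] at hsum
    zify at hsum
    rw [hcardF] at hsum
    rw [hDcard, hprod, Finset.card_product, Finset.card_univ, hS0, hsq, hm2]
    push_cast
    rw [hcardF]
    rw [hm] at hsum ⊢
    linear_combination m * hsum
  · obtain ⟨t, ht⟩ := exists_sum_pow_two_pow_eq_one he hF
    have hhalf := two_mul_card_filter_eq_zero_of_map_add_one
      (fun p : F × F => Tr (a * p.1 ^ (2 ^ h + 1) + b * p.2))
      ((Equiv.refl F).prodCongr (Equiv.addRight (b⁻¹ * t)))
      (fun p => by simpa only [hTr] using sum_pow_two_pow_eq_zero_or_one hF _)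
      (fun p => by
        have hadd : a * p.1 ^ (2 ^ h + 1) + b * (p.2 + b⁻¹ * t) =
            (a * p.1 ^ (2 ^ h + 1) + b * p.2) + t := by
          field_simp
          ring
        simp only [Equiv.prodCongr_apply, Prod.map_fst, Prod.map_snd, Equiv.refl_apply,
          Equiv.coe_addRight, hadd]
        rw [hTr, hTr, sum_pow_two_pow_add, ht])
    rw [Fintype.card_prod] at hhalf
    zify at hhalf
    rw [hcardF] at hhalf
    rw [hDcard, hsq]
    have : q * q = 2 * (q * m) := by rw [hm]; ring
    linarith
end

section
/- Assume e/h is odd (note that then e ≡ h (mod 2)). Then for every a ∈ F_q^* and b ∈ F_q: |D_{(a,b)}| = q²/2 − 1, and among the q² − 1 pairs (u,v) ∈ F_q² with (u,v) ≠ (0,0), exactly q² − 2^{e−h} − 1 pairs satisfy wt(c_{(u,v)}) = q²/4, exactly 2^{e−h−1} + 2^{(e−h−2)/2} pairs satisfy wt(c_{(u,v)}) = (q/4)·(q − 2^{(e+h)/2}), and exactly 2^{e−h−1} − 2^{(e−h−2)/2} pairs satisfy wt(c_{(u,v)}) = (q/4)·(q + 2^{(e+h)/2}); in particular no other nonzero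 weights occur. -/
theorem coprime_two_pow_sub_one_two_pow_add_one {e h : ℕ} (hdvd : h ∣ e) (he : 0 < e)
    (hodd : Odd (e / h)) : (2 ^ e - 1).Coprime (2 ^ h + 1) := by
  have hd : 2 ^ h + 1 ∣ 2 ^ e + 1 := by
    have := hodd.nat_add_dvd_pow_add_pow (2 ^ h) 1
    rwa [one_pow, ← pow_mul, Nat.mul_div_cancel' hdvd] at this
  refine Nat.Coprime.coprime_dvd_right hd ?_
  have h1 : 1 ≤ 2 ^ e := Nat.one_le_two_pow
  have h2 : 2 ^ e + 1 = 2 + (2 ^ e - 1) := by omega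
  rw [h2, Nat.coprime_add_self_right, Nat.coprime_two_right]
  exact Nat.Even.sub_odd h1 ((Nat.even_pow.2 ⟨even_two, he.ne'⟩)) odd_one

section FiniteField

variable {F : Type*} [Field F]

theorem pow_bijective_of_coprime [Fintype F] {n : ℕ} (hn : n ≠ 0)
    (hcop : (Fintype.card F - 1).Coprime n) : Function.Bijective fun z : F => z ^ n := by
  classical
  rw [← Finite.injective_iff_bijective]
  intro x y hxy
  simp only at hxy
  by_cases hx : x = 0
  · subst hx
    rw [zero_pow hn] at hxy
    exact (pow_eq_zero_iff hn |>.1 hxy.symm).symm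
  have hy : y ≠ 0 := by
    rintro rfl
    rw [zero_pow hn] at hxy
    exact hx (pow_eq_zero_iff hn |>.1 hxy)
  have hc : (Nat.card Fˣ).Coprime n := by
    rwa [Nat.card_eq_fintype_card, Fintype.card_units]
  have := (powCoprime hc).injective (a₁ := Units.mk0 x hx) (a₂ := Units.mk0 y hy)
    (Units.ext (by simpa using hxy))
  simpa using congrArg Units.val this

theorem card_filter_pow_two_pow_eq_self [Fintype F] [DecidableEq F] {e h : ℕ}
    (hF : Fintype.card F = 2 ^ e) (hdvd : h ∣ e) :
    (Finset.univ.filter fun w : F => w ^ 2 ^ h = w).card = 2 ^ h := by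
  have hpos : 1 ≤ 2 ^ h := Nat.one_le_two_pow
  have hker := IsCyclic.card_powMonoidHom_ker (G := Fˣ) (2 ^ h - 1)
  rw [Nat.card_eq_fintype_card (α := Fˣ), Fintype.card_units, hF,
    Nat.pow_sub_one_gcd_pow_sub_one, Nat.gcd_eq_right hdvd] at hker
  have himg : (Finset.univ.filter fun w : F => w ^ 2 ^ h = w) =
      insert 0 ((Finset.univ.filter fun w : Fˣ => w ^ (2 ^ h - 1) = 1).image Units.val) := by
    ext w
    simp only [Finset.mem_filter, Finset.mem_univ, true_and, Finset.mem_insert, Finset.mem_image]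
    by_cases hw : w = 0
    · simp [hw]
    have key : w ^ 2 ^ h = w ^ (2 ^ h - 1) * w := by
      rw [← pow_succ, Nat.sub_add_cancel hpos]
    constructor
    · intro hww
      refine Or.inr ⟨Units.mk0 w hw, ?_, rfl⟩
      rw [key] at hww
      ext
      simpa [hw] using hww
    · rintro (h0 | ⟨v, hv, rfl⟩)
      · exact absurd h0 hw
      · rw [key, ← Units.val_pow_eq_pow_val, hv]
        simp
  rw [himg, Finset.card_insert_of_notMem (by simp),
    Finset.card_image_of_injective _ Units.val_injective]
  have : (Finset.univ.filter fun w : Fˣ => w ^ (2 ^ h - 1) = 1).card = 2 ^ h - 1 := by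
    rw [← Fintype.card_subtype]
    refine Eq.trans ?_ hker
    rw [Nat.card_eq_fintype_card]
    exact Fintype.card_congr (Equiv.subtypeEquivRight fun w => by simp [MonoidHom.mem_ker])
  omega

/-- The exponential sum of the function `x ↦ a * x ^ (2 ^ h + 1) + u * x`. -/
def goldSum [Fintype F] (ψ : AddChar F ℤ) (h : ℕ) (a u : F) : ℤ :=
  ∑ x, ψ (a * x ^ (2 ^ h + 1) + u * x)

/-- The radical of the alternating form attached to `x ↦ a * x ^ (2 ^ h + 1)`. -/
def goldRadical [Fintype F] [DecidableEq F] (h : ℕ) (a : F) : Finset F :=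
  Finset.univ.filter fun z => a * z + (a * z ^ 2 ^ h) ^ 2 ^ h = 0

theorem card_goldRadical [Fintype F] [DecidableEq F] [CharP F 2] {e h : ℕ} (hF : Fintype.card F = 2 ^ e)
    (hdvd : h ∣ e) (he : 0 < e) (hodd : Odd (e / h)) {a : F} (ha : a ≠ 0) :
    (goldRadical h a).card = 2 ^ h := by
  rw [← card_filter_pow_two_pow_eq_self hF hdvd]
  have hbij := pow_bijective_of_coprime (F := F) (Nat.succ_ne_zero (2 ^ h))
    (hF ▸ coprime_two_pow_sub_one_two_pow_add_one hdvd he hodd)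
  refine Finset.card_bijective (fun z => a * z ^ (2 ^ h + 1))
    ((mulLeft_bijective₀ a ha).comp hbij) fun z => ?_
  simp only [goldRadical, Finset.mem_filter, Finset.mem_univ, true_and]
  have h1 : (a * z ^ (2 ^ h + 1)) ^ 2 ^ h = (a * z ^ 2 ^ h) ^ 2 ^ h * z ^ 2 ^ h := by
    rw [← mul_pow, mul_assoc, ← pow_succ]
  have h2 : a * z ^ (2 ^ h + 1) = a * z * z ^ 2 ^ h := by ring
  rw [h1, h2]
  by_cases hz : z = 0
  · simp [hz]
  rw [mul_left_inj' (pow_ne_zero _ hz), CharTwo.add_eq_zero, eq_comm]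

section CharTwo

variable {ψ : AddChar F ℤ}

theorem AddChar.mul_self_of_charTwo [CharP F 2] (ψ : AddChar F ℤ) (x : F) : ψ x * ψ x = 1 := by
  rw [← AddChar.map_add_eq_mul, CharTwo.add_self_eq_zero, AddChar.map_zero_eq_one]

theorem AddChar.map_pow_two_pow (hinv : ∀ x, ψ (x ^ 2) = ψ x) (x : F) (n : ℕ) :
    ψ (x ^ 2 ^ n) = ψ x := by
  induction n with
  | zero => simp
  | succ n ih => rw [pow_succ, pow_mul, hinv, ih]

theorem AddChar.map_goldForm [CharP F 2] (hinv : ∀ x, ψ (x ^ 2) = ψ x) (h : ℕ) (a x z : F) :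
    ψ (a * x ^ 2 ^ h * z + a * z ^ 2 ^ h * x) =
      ψ (x ^ 2 ^ h * (a * z + (a * z ^ 2 ^ h) ^ 2 ^ h)) := by
  rw [AddChar.map_add_eq_mul, mul_add, AddChar.map_add_eq_mul, ← mul_pow,
    AddChar.map_pow_two_pow hinv (x * _)]
  congr 2 <;> ring

theorem gold_add [CharP F 2] (h : ℕ) (a u x z : F) :
    a * (x + z) ^ (2 ^ h + 1) + u * (x + z) =
      (a * x ^ (2 ^ h + 1) + u * x) + (a * z ^ (2 ^ h + 1) + u * z) +
        (a * x ^ 2 ^ h * z + a * z ^ 2 ^ h * x) := by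
  rw [pow_succ, add_pow_char_pow]
  ring

theorem AddChar.map_gold_add [CharP F 2] (hinv : ∀ x, ψ (x ^ 2) = ψ x) (h : ℕ) (a u x z : F) :
    ψ (a * (x + z) ^ (2 ^ h + 1) + u * (x + z)) =
      ψ (a * x ^ (2 ^ h + 1) + u * x) * ψ (a * z ^ (2 ^ h + 1) + u * z) *
        ψ (x ^ 2 ^ h * (a * z + (a * z ^ 2 ^ h) ^ 2 ^ h)) := by
  rw [gold_add, AddChar.map_add_eq_mul, AddChar.map_add_eq_mul, AddChar.map_goldForm hinv]

theorem sum_comp_pow_two_pow [Fintype F] [CharP F 2] (h : ℕ) (f : F → ℤ) : ∑ x, f (x ^ 2 ^ h) = ∑ x, f x := by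
  have hb : Function.Bijective fun x : F => x ^ 2 ^ h :=
    (Finite.injective_iff_bijective).1 (iterateFrobenius F 2 h).injective
  exact hb.sum_comp f

theorem goldSum_sq [Fintype F] [CharP F 2] [DecidableEq F] (hψ : ψ.IsPrimitive) (hinv : ∀ x, ψ (x ^ 2) = ψ x) (h : ℕ)
    (a u : F) : goldSum ψ h a u ^ 2 =
      Fintype.card F * ∑ z ∈ goldRadical h a, ψ (a * z ^ (2 ^ h + 1) + u * z) := by
  have hinner (z : F) : ∑ x, ψ (a * x ^ (2 ^ h + 1) + u * x) *
      ψ (a * (x + z) ^ (2 ^ h + 1) + u * (x + z)) =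
      if a * z + (a * z ^ 2 ^ h) ^ 2 ^ h = 0 then
        Fintype.card F * ψ (a * z ^ (2 ^ h + 1) + u * z) else 0 := by
    simp_rw [AddChar.map_gold_add hinv, ← mul_assoc, AddChar.mul_self_of_charTwo, one_mul]
    rw [← Finset.mul_sum, sum_comp_pow_two_pow h
      fun y => ψ (y * (a * z + (a * z ^ 2 ^ h) ^ 2 ^ h)), AddChar.sum_mulShift _ hψ]
    split_ifs <;> simp [mul_comm]
  calc goldSum ψ h a u ^ 2
      = ∑ x, ∑ z, ψ (a * x ^ (2 ^ h + 1) + u * x) *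
          ψ (a * (x + z) ^ (2 ^ h + 1) + u * (x + z)) := by
        rw [sq, goldSum, Finset.sum_mul]
        refine Finset.sum_congr rfl fun x _ => ?_
        rw [Finset.mul_sum]
        exact (Equiv.sum_comp (Equiv.addLeft x) fun y => ψ (a * x ^ (2 ^ h + 1) + u * x) *
          ψ (a * y ^ (2 ^ h + 1) + u * y)).symm
    _ = _ := by
        rw [Finset.sum_comm, Finset.mul_sum, goldRadical, Finset.sum_filter]
        exact Finset.sum_congr rfl fun z _ => hinner z

theorem goldSum_sq_eq_zero_or [Fintype F] [CharP F 2] [DecidableEq F] (hψ : ψ.IsPrimitive)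
    (hinv : ∀ x, ψ (x ^ 2) = ψ x) (h : ℕ) (a u : F) :
    goldSum ψ h a u ^ 2 = 0 ∨
      goldSum ψ h a u ^ 2 = Fintype.card F * (goldRadical h a).card := by
  rw [goldSum_sq hψ hinv]
  by_cases hall : ∀ z ∈ goldRadical h a, ψ (a * z ^ (2 ^ h + 1) + u * z) = 1
  · right
    rw [Finset.sum_congr rfl hall]
    simp
  · left
    push Not at hall
    obtain ⟨w, hw, hne⟩ := hall
    have hw' : a * w + (a * w ^ 2 ^ h) ^ 2 ^ h = 0 := by simpa [goldRadical] using hw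
    have hmem (z : F) : z ∈ goldRadical h a ↔ z + w ∈ goldRadical h a := by
      have : a * (z + w) + (a * (z + w) ^ 2 ^ h) ^ 2 ^ h =
          (a * z + (a * z ^ 2 ^ h) ^ 2 ^ h) + (a * w + (a * w ^ 2 ^ h) ^ 2 ^ h) := by
        rw [add_pow_char_pow, mul_add, mul_add, add_pow_char_pow]
        ring
      simp only [goldRadical, Finset.mem_filter, Finset.mem_univ, true_and, this, hw', add_zero]
    have hshift : ∑ z ∈ goldRadical h a, ψ (a * z ^ (2 ^ h + 1) + u * z) =
        ψ (a * w ^ (2 ^ h + 1) + u * w) *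
          ∑ z ∈ goldRadical h a, ψ (a * z ^ (2 ^ h + 1) + u * z) := by
      conv_lhs => rw [← Finset.sum_equiv (Equiv.addRight w) hmem fun z _ => rfl]
      rw [Finset.mul_sum]
      refine Finset.sum_congr rfl fun z _ => ?_
      rw [Equiv.coe_addRight, AddChar.map_gold_add hinv, hw', mul_zero, AddChar.map_zero_eq_one,
        mul_one, mul_comm]
    have := mul_eq_zero.1 (show (ψ (a * w ^ (2 ^ h + 1) + u * w) - 1) *
      ∑ z ∈ goldRadical h a, ψ (a * z ^ (2 ^ h + 1) + u * z) = 0 by linarith)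
    rw [this.resolve_left (sub_ne_zero.2 hne), mul_zero]

theorem sum_goldSum [Fintype F] [DecidableEq F] (hψ : ψ.IsPrimitive) (h : ℕ) (a : F) :
    ∑ u, goldSum ψ h a u = Fintype.card F := by
  simp_rw [goldSum]
  rw [Finset.sum_comm]
  simp_rw [AddChar.map_add_eq_mul, ← Finset.mul_sum, AddChar.sum_mulShift _ hψ]
  simp

theorem sum_goldSum_sq [Fintype F] [CharP F 2] [DecidableEq F] (hψ : ψ.IsPrimitive) (h : ℕ) (a : F) :
    ∑ u, goldSum ψ h a u ^ 2 = (Fintype.card F : ℤ) ^ 2 := by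
  have key (u x y : F) : ψ (a * x ^ (2 ^ h + 1) + u * x) * ψ (a * y ^ (2 ^ h + 1) + u * y) =
      ψ (a * x ^ (2 ^ h + 1)) * ψ (a * y ^ (2 ^ h + 1)) * ψ (u * (x + y)) := by
    simp only [mul_add, AddChar.map_add_eq_mul]
    ring
  simp_rw [sq, goldSum, Finset.sum_mul_sum, key]
  rw [Finset.sum_comm]
  have (x : F) : ∑ u, ∑ y, ψ (a * x ^ (2 ^ h + 1)) * ψ (a * y ^ (2 ^ h + 1)) * ψ (u * (x + y)) =
      Fintype.card F := by
    rw [Finset.sum_comm]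
    simp_rw [← Finset.mul_sum, AddChar.sum_mulShift _ hψ, CharTwo.add_eq_zero]
    simp [AddChar.mul_self_of_charTwo]
  simp [this]

theorem goldSum_zero [Fintype F] [DecidableEq F] (hψ : ψ.IsPrimitive) {h : ℕ} {a : F} (ha : a ≠ 0)
    (hcop : (Fintype.card F - 1).Coprime (2 ^ h + 1)) : goldSum ψ h a 0 = 0 := by
  have hbij := pow_bijective_of_coprime (F := F) (Nat.succ_ne_zero (2 ^ h)) hcop
  simp only [goldSum, zero_mul, add_zero, mul_comm a]
  rw [hbij.sum_comp fun y => ψ (y * a), AddChar.sum_mulShift _ hψ, if_neg ha, Nat.cast_zero]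

theorem sum_prod_gold [Fintype F] [DecidableEq F] (hψ : ψ.IsPrimitive) (h : ℕ) (a u w : F) :
    ∑ p : F × F, ψ (a * p.1 ^ (2 ^ h + 1) + u * p.1 + w * p.2) =
      goldSum ψ h a u * if w = 0 then (Fintype.card F : ℤ) else 0 := by
  have hw : ∑ y, ψ (w * y) = if w = 0 then (Fintype.card F : ℤ) else 0 := by
    simp_rw [mul_comm w, AddChar.sum_mulShift _ hψ, Nat.cast_ite, Nat.cast_zero]
  rw [← hw, goldSum, Finset.sum_mul_sum, Fintype.sum_prod_type]
  simp_rw [AddChar.map_add_eq_mul]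

theorem sum_prod_linear [Fintype F] [DecidableEq F] (hψ : ψ.IsPrimitive) {u v : F}
    (huv : (u, v) ≠ (0, 0)) : ∑ p : F × F, ψ (u * p.1 + v * p.2) = 0 := by
  have key := sum_prod_gold hψ 0 0 u v
  simp only [zero_mul, zero_add, goldSum] at key
  rw [key]
  by_cases hv : v = 0
  · have hu : u ≠ 0 := fun hu => huv (by rw [hu, hv])
    simp_rw [mul_comm u, AddChar.sum_mulShift _ hψ, if_neg hu, Nat.cast_zero, zero_mul]
  · rw [if_neg hv, mul_zero]

theorem sum_range_pow_two_pow_sq [Fintype F] [CharP F 2] {e : ℕ} (hF : Fintype.card F = 2 ^ e)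
    (x : F) : (∑ i ∈ Finset.range e, x ^ 2 ^ i) ^ 2 = ∑ i ∈ Finset.range e, x ^ 2 ^ i := by
  have h1 : (∑ i ∈ Finset.range e, x ^ 2 ^ i) ^ 2 = ∑ i ∈ Finset.range e, x ^ 2 ^ (i + 1) := by
    rw [CharTwo.sum_sq]
    simp_rw [← pow_mul, ← pow_succ]
  have h2 := Finset.sum_range_succ (fun i => x ^ 2 ^ i) e
  rw [Finset.sum_range_succ'] at h2
  simp only [pow_zero, pow_one, ← hF, FiniteField.pow_card] at h2
  rw [h1]
  exact add_right_cancel h2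

theorem exists_sum_range_pow_two_pow_ne_zero [Fintype F] {e : ℕ} (he : 0 < e)
    (hF : Fintype.card F = 2 ^ e) : ∃ x : F, ∑ i ∈ Finset.range e, x ^ 2 ^ i ≠ 0 := by
  classical
  by_contra! hall
  let p : Polynomial F := ∑ i ∈ Finset.range e, Polynomial.X ^ 2 ^ i
  have hdeg : p.natDegree ≤ 2 ^ (e - 1) := by
    refine Polynomial.natDegree_sum_le_of_forall_le _ _ fun i hi => ?_
    rw [Polynomial.natDegree_X_pow]
    exact Nat.pow_le_pow_right two_pos (by have := Finset.mem_range.1 hi; omega)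
  have hp : p = 0 := by
    refine Polynomial.eq_zero_of_natDegree_lt_card_of_eval_eq_zero' p Finset.univ
      (fun x _ => ?_) ?_
    · simpa [p, Polynomial.eval_finsetSum] using hall x
    · rw [Finset.card_univ, hF]
      exact hdeg.trans_lt (Nat.pow_lt_pow_right one_lt_two (by omega))
  have hcoeff : p.coeff 1 = 1 := by
    simp only [p, Polynomial.finsetSum_coeff, Polynomial.coeff_X_pow]
    rw [Finset.sum_eq_single 0]
    · simp
    · intro i _ hi
      rw [if_neg]
      exact (Nat.one_lt_two_pow hi).ne
    · intro h0
      exact absurd (Finset.mem_range.2 he) h0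
  rw [hp, Polynomial.coeff_zero] at hcoeff
  exact zero_ne_one hcoeff

/-- The sign character `x ↦ (-1) ^ Tr x` of a finite field of characteristic two. -/
theorem exists_traceChar [Fintype F] [DecidableEq F] [CharP F 2] {e : ℕ} (he : 0 < e)
    (hF : Fintype.card F = 2 ^ e) {Tr : F → F}
    (hTr : ∀ x, Tr x = ∑ i ∈ Finset.range e, x ^ 2 ^ i) :
    ∃ ψ : AddChar F ℤ, ψ.IsPrimitive ∧ (∀ x, ψ (x ^ 2) = ψ x) ∧
      (∀ x, (if Tr x = 0 then (2 : ℤ) else 0) = 1 + ψ x) ∧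
      (∀ x, (if Tr x = 1 then (2 : ℤ) else 0) = 1 - ψ x) := by
  have h01 (x : F) : Tr x = 0 ∨ Tr x = 1 := by
    have := sum_range_pow_two_pow_sq hF x
    rw [← hTr] at this
    rcases eq_or_ne (Tr x) 0 with h0 | h0
    · exact Or.inl h0
    · exact Or.inr (mul_left_cancel₀ h0 (by rw [← sq, this, mul_one]))
  have hadd (x y : F) : Tr (x + y) = Tr x + Tr y := by
    simp_rw [hTr, add_pow_char_pow, Finset.sum_add_distrib]
  let ψ : AddChar F ℤ :=
    { toFun := fun x => if Tr x = 0 then 1 else -1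
      map_zero_eq_one' := by
        have : Tr 0 + Tr 0 = Tr 0 := by rw [← hadd, add_zero]
        rw [add_eq_left.1 this, if_pos rfl]
      map_add_eq_mul' := fun x y => by
        rw [hadd]
        rcases h01 x with hx | hx <;> rcases h01 y with hy | hy <;>
          simp [hx, hy, CharTwo.add_self_eq_zero] }
  have hψ (x : F) : ψ x = if Tr x = 0 then 1 else -1 := rfl
  refine ⟨ψ, AddChar.IsPrimitive.of_ne_one fun h1 => ?_, fun x => ?_, fun x => ?_, fun x => ?_⟩
  · obtain ⟨x, hx⟩ := exists_sum_range_pow_two_pow_ne_zero he hF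
    have := hψ x
    rw [if_neg (by rwa [hTr]), h1] at this
    norm_num at this
  · have : Tr (x ^ 2) = Tr x := by
      rw [hTr, hTr, ← sum_range_pow_two_pow_sq hF x, CharTwo.sum_sq]
      exact Finset.sum_congr rfl fun i _ => by rw [← pow_mul, ← pow_mul, mul_comm]
    rw [hψ, hψ, this]
  · rw [hψ]
    split_ifs <;> norm_num
  · rw [hψ]
    rcases h01 x with hx | hx <;> simp [hx]

end CharTwo

end FiniteField

theorem card_filter_eq_of_sq_eq_zero_or {ι : Type*} [Fintype ι] {S : ι → ℤ} {s q : ℤ}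
    (hs : 0 < s) (hS : ∀ u, S u ^ 2 = 0 ∨ S u ^ 2 = s ^ 2) (h1 : ∑ u, S u = q)
    (h2 : ∑ u, S u ^ 2 = q ^ 2) :
    (((Finset.univ.filter fun u => S u = s).card : ℤ) +
        (Finset.univ.filter fun u => S u = -s).card) * s ^ 2 = q ^ 2 ∧
      (((Finset.univ.filter fun u => S u = s).card : ℤ) -
        (Finset.univ.filter fun u => S u = -s).card) * s = q := by
  have hval (u : ι) : S u = 0 ∨ S u = s ∨ S u = -s := by
    rcases hS u with h0 | h0
    · exact Or.inl (pow_eq_zero_iff two_ne_zero |>.1 h0)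
    · exact Or.inr (sq_eq_sq_iff_eq_or_eq_neg.1 h0)
  have hne : s ≠ -s := by omega
  rw [← h2, ← h1]
  simp only [Finset.card_filter, Nat.cast_sum, ← Finset.sum_add_distrib,
    ← Finset.sum_sub_distrib, Finset.sum_mul]
  constructor
  all_goals
    refine Finset.sum_congr rfl fun u _ => ?_
    rcases hval u with hu | hu | hu <;> simp [hu, hs.ne, hs.ne', hne, hne.symm]


/-- Theorem 1: `e/h` odd. Then `|D_{(a,b)}| = q²/2 − 1` and the weight distribution is:
`q² − 2^{e−h} − 1` codewords of weight `q²/4`, `2^{e−h−1} + 2^{(e−h−2)/2}` of weight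
`(q/4)(q − 2^{(e+h)/2})`, and `2^{e−h−1} − 2^{(e−h−2)/2}` of weight
`(q/4)(q + 2^{(e+h)/2})`; no other nonzero weights occur. -/
theorem stmt_8
    (e h : ℕ) (hdvd : h ∣ e) (hh0 : 0 < h) (hhe : h < e)
    (hodd : Odd (e / h))
    (F : Type) [Field F] [Fintype F] [DecidableEq F]
    (hF : Fintype.card F = 2 ^ e)
    (q : ℤ) (hq : q = 2 ^ e)
    (Tr : F → F) (hTr : ∀ x, Tr x = ∑ i ∈ Finset.range e, x ^ 2 ^ i)
    (a b : F) (ha : a ≠ 0)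
    (D : Finset (F × F))
    (hD : D = Finset.univ.filter fun p : F × F =>
        p ≠ (0, 0) ∧ Tr (a * p.1 ^ (2 ^ h + 1) + b * p.2) = 0)
    (wt : F × F → ℕ)
    (hwt : ∀ u v : F, wt (u, v) =
        (D.filter fun p => Tr (u * p.1 + v * p.2) = 1).card) :
    ((D.card : ℤ) = q ^ 2 / 2 - 1) ∧
    (((Finset.univ.filter fun uv : F × F =>
        uv ≠ (0, 0) ∧ (wt uv : ℤ) = q ^ 2 / 4).card : ℤ)
      = q ^ 2 - 2 ^ (e - h) - 1) ∧
    (((Finset.univ.filter fun uv : F × F =>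
        uv ≠ (0, 0) ∧ (wt uv : ℤ) = q / 4 * (q - 2 ^ ((e + h) / 2))).card : ℤ)
      = 2 ^ (e - h - 1) + 2 ^ ((e - h - 2) / 2)) ∧
    (((Finset.univ.filter fun uv : F × F =>
        uv ≠ (0, 0) ∧ (wt uv : ℤ) = q / 4 * (q + 2 ^ ((e + h) / 2))).card : ℤ)
      = 2 ^ (e - h - 1) - 2 ^ ((e - h - 2) / 2)) ∧
    (∀ uv : F × F, uv ≠ (0, 0) →
      (wt uv : ℤ) = q ^ 2 / 4 ∨
      (wt uv : ℤ) = q / 4 * (q - 2 ^ ((e + h) / 2)) ∨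
      (wt uv : ℤ) = q / 4 * (q + 2 ^ ((e + h) / 2))) := by
  have he : 0 < e := hh0.trans hhe
  have : CharP F 2 := charP_of_card_eq_prime_pow hF
  have hcop : (Fintype.card F - 1).Coprime (2 ^ h + 1) :=
    hF ▸ coprime_two_pow_sub_one_two_pow_add_one hdvd he hodd
  obtain ⟨ψ, hψ, hinv, hψ0, hψ1⟩ := exists_traceChar he hF hTr
  have hFq : (Fintype.card F : ℤ) = q := by rw [hF, hq]; push_cast; rfl
  obtain ⟨j, hj, hej⟩ : ∃ j, 0 < j ∧ e = h + 2 * j := by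
    obtain ⟨c, rfl⟩ := hdvd
    rw [Nat.mul_div_cancel_left _ hh0] at hodd
    obtain ⟨m, rfl⟩ := hodd
    refine ⟨h * m, Nat.mul_pos hh0 (Nat.pos_of_ne_zero ?_), by ring⟩
    rintro rfl
    simp at hhe
  obtain ⟨i, rfl⟩ : ∃ i, j = i + 1 := ⟨j - 1, by omega⟩
  have hs_exp : (e + h) / 2 = h + i + 1 := by omega
  have he1 : e - h = 2 * i + 2 := by omega
  have he2 : e - h - 1 = 2 * i + 1 := by omega
  have he3 : (e - h - 2) / 2 = i := by omega
  rw [hs_exp, he2, he3, he1]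
  set s : ℤ := 2 ^ (h + i + 1) with hs
  have hspos : 0 < s := by positivity
  have hqs : q = s * 2 ^ (i + 1) := by
    rw [hq, hs, ← pow_add]; congr 1; omega
  have hqh : q * 2 ^ h = s ^ 2 := by
    rw [hq, hs, ← pow_add, ← pow_mul]; congr 1; omega
  obtain ⟨r, hr⟩ : ∃ r : ℤ, q = 4 * r := by
    refine ⟨2 ^ (e - 2), ?_⟩
    rw [hq, show (4 : ℤ) = 2 ^ 2 by norm_num, ← pow_add]; congr 1; omega
  have hqpos : 0 < q := by rw [hq]; positivity
  let S : F → ℤ := goldSum ψ h a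
  have hS0 : S 0 = 0 := goldSum_zero hψ ha hcop
  have hSsq (u : F) : S u ^ 2 = 0 ∨ S u ^ 2 = s ^ 2 := by
    have := goldSum_sq_eq_zero_or hψ hinv h a u
    rw [card_goldRadical hF hdvd he hodd ha, hFq] at this
    push_cast at this
    rwa [hqh] at this
  have hSval (u : F) : S u = 0 ∨ S u = s ∨ S u = -s := by
    rcases hSsq u with h0 | h0
    · exact Or.inl (pow_eq_zero_iff two_ne_zero |>.1 h0)
    · exact Or.inr (sq_eq_sq_iff_eq_or_eq_neg.1 h0)
  obtain ⟨hN2, hN1⟩ := card_filter_eq_of_sq_eq_zero_or hspos hSsq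
    ((sum_goldSum hψ h a).trans hFq) ((sum_goldSum_sq hψ h a).trans (by rw [hFq]))
  set Np : ℤ := ((Finset.univ.filter fun u => S u = s).card : ℤ) with hNp
  set Nm : ℤ := ((Finset.univ.filter fun u => S u = -s).card : ℤ) with hNm
  have hNsub : Np - Nm = 2 ^ (i + 1) :=
    mul_right_cancel₀ hspos.ne' (by rw [hN1, hqs, mul_comm])
  have hNadd : Np + Nm = 2 ^ (2 * i + 2) :=
    mul_right_cancel₀ (pow_ne_zero 2 hspos.ne') (by rw [hN2, hqs]; ring)
  have hNpv : Np = 2 ^ (2 * i + 1) + 2 ^ i := by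
    rw [pow_succ] at hNsub hNadd; linarith
  have hNmv : Nm = 2 ^ (2 * i + 1) - 2 ^ i := by
    rw [pow_succ] at hNsub hNadd; linarith
  have hf0 : ∑ p : F × F, ψ (a * p.1 ^ (2 ^ h + 1) + b * p.2) = 0 := by
    have := sum_prod_gold hψ h a 0 b
    simpa only [zero_mul, add_zero, show goldSum ψ h a 0 = 0 from hS0] using this
  have hcard2 : ∑ _p : F × F, (1 : ℤ) = q ^ 2 := by
    simp [Fintype.card_prod, hFq, sq]
  have hψz : ψ 0 = 1 := AddChar.map_zero_eq_one ψ
  have hDcard : 2 * ((D.card : ℤ) + 1) = q ^ 2 := by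
    have hT0 : Tr 0 = 0 := by
      by_contra hne
      have := hψ0 0
      rw [if_neg hne, hψz] at this
      norm_num at this
    have hDe : D = (Finset.univ.filter fun p : F × F =>
        Tr (a * p.1 ^ (2 ^ h + 1) + b * p.2) = 0).erase (0, 0) := by
      rw [hD]; ext p; simp
    have hins : D.card + 1 = (Finset.univ.filter fun p : F × F =>
        Tr (a * p.1 ^ (2 ^ h + 1) + b * p.2) = 0).card := by
      rw [hDe]
      exact Finset.card_erase_add_one (by simp [hT0])
    rw [← Nat.cast_succ, Nat.succ_eq_add_one, hins, Finset.card_filter, Nat.cast_sum,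
      Finset.mul_sum, ← add_zero (q ^ 2), ← hf0, ← hcard2, ← Finset.sum_add_distrib]
    refine Finset.sum_congr rfl fun p _ => ?_
    rw [← hψ0]
    split_ifs <;> simp
  have hwt4 (u v : F) (huv : (u, v) ≠ (0, 0)) :
      4 * (wt (u, v) : ℤ) = q ^ 2 - if v = b then q * S u else 0 := by
    have hsum : 4 * (wt (u, v) : ℤ) = ∑ p : F × F,
        (1 + ψ (a * p.1 ^ (2 ^ h + 1) + b * p.2)) * (1 - ψ (u * p.1 + v * p.2)) := by
      rw [hwt, hD, Finset.filter_filter, Finset.card_filter, Nat.cast_sum, Finset.mul_sum]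
      refine Finset.sum_congr rfl fun p _ => ?_
      by_cases hp : p = (0, 0)
      · simp [hp]
      · rw [← hψ0, ← hψ1]
        by_cases h1 : Tr (a * p.1 ^ (2 ^ h + 1) + b * p.2) = 0 <;>
          by_cases h2 : Tr (u * p.1 + v * p.2) = 1 <;> simp [hp, h1, h2]
    have hfl : ∑ p : F × F, ψ (a * p.1 ^ (2 ^ h + 1) + b * p.2) * ψ (u * p.1 + v * p.2) =
        if v = b then q * S u else 0 := by
      have := sum_prod_gold hψ h a u (b + v)
      simp only [hFq, CharTwo.add_eq_zero, eq_comm (a := b)] at this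
      rw [show (if v = b then q * S u else 0) = goldSum ψ h a u * if v = b then q else 0 by
        split_ifs <;> simp [S, mul_comm], ← this]
      refine Finset.sum_congr rfl fun p _ => ?_
      rw [← AddChar.map_add_eq_mul]
      congr 1
      ring
    rw [hsum, ← hfl, ← hcard2]
    simp_rw [add_mul, one_mul, mul_sub, mul_one, Finset.sum_add_distrib, Finset.sum_sub_distrib,
      hf0, sum_prod_linear hψ huv]
    ring
  have hdiv2 : q ^ 2 / 2 = 8 * r ^ 2 := by
    rw [hr, show (4 * r) ^ 2 = 2 * (8 * r ^ 2) by ring]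
    exact Int.mul_ediv_cancel_left _ two_ne_zero
  have hdiv4 : q ^ 2 / 4 = 4 * r ^ 2 := by
    rw [hr, show (4 * r) ^ 2 = 4 * (4 * r ^ 2) by ring]
    exact Int.mul_ediv_cancel_left _ four_ne_zero
  have hq4 : q / 4 = r := by
    rw [hr]; exact Int.mul_ediv_cancel_left _ four_ne_zero
  have hrpos : 0 < r := by linarith
  rw [hdiv2, hdiv4, hq4]
  let T : F × F → ℤ := fun p => if p.2 = b then S p.1 else 0
  have hwtT (p : F × F) (hp : p ≠ (0, 0)) : (wt p : ℤ) = r * (q - T p) := by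
    have := hwt4 p.1 p.2 hp
    rw [hr] at this ⊢
    simp only [T]
    split_ifs at this ⊢ <;> linarith
  have hTz : T (0, 0) = 0 := by simp [T, hS0]
  have hwt_iff (t : ℤ) (p : F × F) :
      (p ≠ (0, 0) ∧ (wt p : ℤ) = r * (q - t)) ↔ p ≠ (0, 0) ∧ T p = t := by
    refine and_congr_right fun hp => ?_
    rw [hwtT p hp, mul_right_inj' hrpos.ne', sub_right_inj]
  have hTval (p : F × F) : T p = 0 ∨ T p = s ∨ T p = -s := by
    simp only [T]
    split_ifs
    · exact hSval _
    · exact Or.inl rfl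
  have hTcard (t : ℤ) (ht : t ≠ 0) : (Finset.univ.filter fun p : F × F => p ≠ (0, 0) ∧ T p = t).card
      = (Finset.univ.filter fun u => S u = t).card := by
    have : (Finset.univ.filter fun p : F × F => p ≠ (0, 0) ∧ T p = t) =
        (Finset.univ.filter fun u => S u = t).image fun u => (u, b) := by
      ext ⟨u, v⟩
      simp only [Finset.mem_filter, Finset.mem_univ, true_and, Finset.mem_image, Prod.mk.injEq]
      constructor
      · rintro ⟨-, hT⟩
        by_cases hv : v = b
        · exact ⟨u, by simpa [T, hv] using hT, rfl, hv.symm⟩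
        · exact absurd (by simpa [T, hv] using hT.symm) ht
      · rintro ⟨u, hu, rfl, rfl⟩
        have hT : T (u, b) = t := by simpa [T] using hu
        exact ⟨fun h0 => ht (by rw [← hT, h0, hTz]), hT⟩
    rw [this, Finset.card_image_of_injective _ fun x y hxy => (Prod.mk.inj hxy).1]
  have hw0 : 4 * r ^ 2 = r * (q - 0) := by rw [hr]; ring
  have hwm : r * (q + s) = r * (q - -s) := by ring
  have hcp := hTcard s hspos.ne'
  have hcm := hTcard (-s) (neg_ne_zero.2 hspos.ne')
  have hsum3 : ((Finset.univ.filter fun p : F × F => p ≠ (0, 0) ∧ T p = 0).card : ℤ) + Np + Nm + 1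
      = q ^ 2 := by
    rw [hNp, hNm, ← hcp, ← hcm, ← hcard2]
    have h1 : (1 : ℤ) = ∑ p : F × F, if p = (0, 0) then 1 else 0 := by simp
    nth_rewrite 1 [h1]
    simp only [Finset.card_filter, Nat.cast_sum, ← Finset.sum_add_distrib]
    refine Finset.sum_congr rfl fun p _ => ?_
    have hne : s ≠ -s := by omega
    by_cases hp : p = (0, 0)
    · simp [hp]
    · rcases hTval p with h | h | h <;>
        simp [hp, h, hspos.ne, hspos.ne', hne, hne.symm]
  rw [hw0, hwm]
  simp_rw [hwt_iff]
  refine ⟨?_, ?_, ?_, ?_, fun p hp => ?_⟩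
  · rw [hr] at hDcard; linarith
  · linarith
  · rw [hcp, ← hNp, hNpv]
  · rw [hcm, ← hNm, hNmv]
  · rw [hwtT p hp]
    rcases hTval p with h | h | h <;> simp [h]
end

section
/- Assume e/h is even and write e = 2m. Let b ∈ F_q^* and let a ∈ F_q^* NOT be a (2^h+1)-th power in F_q^* (i.e., a ≠ c^{2^h+1} for all c ∈ F_q^*). Then |D_{(a,b)}| = q²/2 − 1, and among the q² − 1 pairs (u,v) ≠ (0,0), exactly q² − q − 1 pairs satisfy wt(c_{(u,v)}) = q²/4, exactly q/2 + 2^{m−1} pairs satisfy wt(c_{(u,v)}) = (q/4)·(q − 2^m), and exactly q/2 − 2^{m−1} pairs satisfy wt(c_{(u,v)}) = (q/4)·(q + 2^m); no other nonzero weights occur. -/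
open Finset

/-- In a cyclic group whose order is divisible by `k * n`, an element killed by `k` is an
`n`-th power. -/
theorem exists_pow_eq_of_pow_eq_one {G : Type*} [Group G] [Finite G] [IsCyclic G] {k n : ℕ}
    (hk : 0 < k) (hkn : k * n ∣ Nat.card G) {w : G} (hw : w ^ k = 1) : ∃ c : G, c ^ n = w := by
  obtain ⟨g, hg⟩ := IsCyclic.exists_generator (α := G)
  obtain ⟨j, rfl⟩ := Subgroup.mem_zpowers_iff.1 (hg w)
  have h1 : g ^ (j * k) = 1 := by rw [zpow_mul, zpow_natCast, hw]
  have h2 : (Nat.card G : ℤ) ∣ j * k := by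
    rw [← orderOf_eq_card_of_forall_mem_zpowers hg]
    exact orderOf_dvd_iff_zpow_eq_one.2 h1
  have h3 : ((k * n : ℕ) : ℤ) ∣ j * k := (Int.natCast_dvd_natCast.2 hkn).trans h2
  have h4 : (n : ℤ) ∣ j := by
    rw [Nat.cast_mul, mul_comm j] at h3
    exact Int.dvd_of_mul_dvd_mul_left (by exact_mod_cast hk.ne') h3
  obtain ⟨i, rfl⟩ := h4
  exact ⟨g ^ i, by rw [mul_comm, zpow_mul, zpow_natCast]⟩

/-- If `a` is not a `(2 ^ h + 1)`-th power and `2h ∣ e`, then the linearized polynomial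
`a z + a ^ (2 ^ h) z ^ (2 ^ (2h))` has no nonzero root in the field with `2 ^ e` elements. -/
theorem linearized_ne_zero {F : Type*} [Field F] [Fintype F] [CharP F 2] {e h : ℕ}
    (hh : 0 < h) (hdvd : 2 * h ∣ e) (hF : Fintype.card F = 2 ^ e) {a : F} (ha : a ≠ 0)
    (ha' : ∀ c : F, c ≠ 0 → a ≠ c ^ (2 ^ h + 1)) {z : F} (hz : z ≠ 0) :
    a * z + a ^ 2 ^ h * z ^ 2 ^ (2 * h) ≠ 0 := by
  intro h0
  have hpos : 1 ≤ 2 ^ h := Nat.one_le_two_pow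
  have h1 : a ^ 2 ^ h * z ^ 2 ^ (2 * h) = a * z := by
    rw [← sub_eq_zero, CharTwo.sub_eq_add, add_comm, h0]
  have hw0 : a * z ^ (2 ^ h + 1) ≠ 0 := mul_ne_zero ha (pow_ne_zero _ hz)
  have hw : (a * z ^ (2 ^ h + 1)) ^ (2 ^ h - 1) = 1 := by
    apply mul_right_cancel₀ hw0
    rw [← pow_succ, Nat.sub_add_cancel hpos, one_mul]
    calc (a * z ^ (2 ^ h + 1)) ^ 2 ^ h = a ^ 2 ^ h * z ^ 2 ^ (2 * h) * z ^ 2 ^ h := by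
          rw [two_mul, pow_add 2 h h]; ring
      _ = _ := by rw [h1]; ring
  have hcard : (2 ^ h - 1) * (2 ^ h + 1) ∣ Nat.card Fˣ := by
    rw [Nat.card_units, Nat.card_eq_fintype_card, hF, mul_comm, ← Nat.sq_sub_sq, ← pow_mul,
      one_pow, mul_comm h]
    obtain ⟨k, rfl⟩ := hdvd
    rw [pow_mul 2 (2 * h) k]
    exact (Nat.sub_dvd_pow_sub_pow (2 ^ (2 * h)) 1 k).trans (by rw [one_pow])
  obtain ⟨c, hc⟩ := exists_pow_eq_of_pow_eq_one (w := Units.mk0 _ hw0)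
    (Nat.sub_pos_of_lt (Nat.one_lt_two_pow hh.ne')) hcard (by ext; simpa using hw)
  have hc' : (c : F) ^ (2 ^ h + 1) = a * z ^ (2 ^ h + 1) := by
    simpa using congrArg Units.val hc
  refine ha' (c / z) (div_ne_zero c.ne_zero hz) ?_
  rw [div_pow, hc', mul_div_cancel_right₀ _ (pow_ne_zero _ hz)]

/-- The quadratic exponential sum of a nondegenerate Gold form has square `|F|`. -/
theorem sq_sum_gold {F : Type*} [Field F] [Fintype F] [CharP F 2] {ψ : AddChar F ℤ}
    (hψ : ψ.IsPrimitive) (hfrob : ∀ x, ψ (x ^ 2) = ψ x) {h : ℕ} {a : F}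
    (ha : ∀ z : F, z ≠ 0 → a * z + a ^ 2 ^ h * z ^ 2 ^ (2 * h) ≠ 0) (u : F) :
    (∑ x, ψ (a * x ^ (2 ^ h + 1) + u * x)) ^ 2 = Fintype.card F := by
  classical
  have hfrob' : ∀ (n : ℕ) (x : F), ψ (x ^ 2 ^ n) = ψ x := by
    intro n
    induction n with
    | zero => simp
    | succ n ih => intro x; rw [pow_succ, pow_mul, hfrob, ih]
  have key : ∀ x z : F, ψ (a * x ^ (2 ^ h + 1) + u * x)
      * ψ (a * (x + z) ^ (2 ^ h + 1) + u * (x + z))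
      = ψ (a * z ^ (2 ^ h + 1) + u * z)
        * ψ (x ^ 2 ^ h * (a * z + a ^ 2 ^ h * z ^ 2 ^ (2 * h))) := by
    intro x z
    have e1 : ψ (x ^ 2 ^ h * (a ^ 2 ^ h * z ^ 2 ^ (2 * h))) = ψ (a * x * z ^ 2 ^ h) := by
      rw [← hfrob' h (a * x * z ^ 2 ^ h), two_mul, pow_add 2 h h]
      congr 1
      ring
    rw [mul_add (x ^ 2 ^ h), AddChar.map_add_eq_mul ψ (x ^ 2 ^ h * (a * z)), e1,
      ← AddChar.map_add_eq_mul, ← AddChar.map_add_eq_mul, ← AddChar.map_add_eq_mul]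
    congr 1
    have h2 : ∀ y : F, y + y = 0 := CharTwo.add_self_eq_zero
    rw [pow_succ (x + z), add_pow_char_pow]
    linear_combination h2 (a * x ^ (2 ^ h + 1)) + h2 (u * x)
  have hbij : Function.Bijective fun x : F => x ^ 2 ^ h := by
    rw [← Finite.injective_iff_bijective]
    exact iterateFrobenius_inj F 2 h
  calc (∑ x, ψ (a * x ^ (2 ^ h + 1) + u * x)) ^ 2
      = ∑ x, ∑ z, ψ (a * x ^ (2 ^ h + 1) + u * x)
          * ψ (a * (x + z) ^ (2 ^ h + 1) + u * (x + z)) := by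
        rw [sq, sum_mul]
        refine sum_congr rfl fun x _ => ?_
        rw [mul_sum]
        exact (Equiv.sum_comp (Equiv.addLeft x) fun y =>
          ψ (a * x ^ (2 ^ h + 1) + u * x) * ψ (a * y ^ (2 ^ h + 1) + u * y)).symm
    _ = ∑ z, ψ (a * z ^ (2 ^ h + 1) + u * z)
          * ∑ y, ψ (y * (a * z + a ^ 2 ^ h * z ^ 2 ^ (2 * h))) := by
        rw [sum_comm]
        refine sum_congr rfl fun z _ => ?_
        rw [← hbij.sum_comp fun y => ψ (y * (a * z + a ^ 2 ^ h * z ^ 2 ^ (2 * h))), mul_sum]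
        exact sum_congr rfl fun x _ => key x z
    _ = Fintype.card F := by
        rw [sum_eq_single 0]
        · simp [Finset.card_univ]
        · intro z _ hz
          rw [AddChar.sum_mulShift _ hψ, if_neg (ha z hz), Nat.cast_zero, mul_zero]
        · simp

/-- The sign character `x ↦ (-1) ^ Tr x` of a finite field of characteristic two, for `Tr` the
absolute trace. -/
theorem exists_addChar_trace {F : Type*} [Field F] [Fintype F] [DecidableEq F] [CharP F 2] {e : ℕ}
    (hF : Fintype.card F = 2 ^ e) {Tr : F → F} (hTr : ∀ x, Tr x = ∑ i ∈ range e, x ^ 2 ^ i) :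
    ∃ ψ : AddChar F ℤ, ψ.IsPrimitive ∧ (∀ x, ψ (x ^ 2) = ψ x) ∧
      ∀ x, Tr x = 0 ∧ ψ x = 1 ∨ Tr x = 1 ∧ ψ x = -1 := by
  let _ : Algebra (ZMod 2) F := ZMod.algebra F 2
  have hrank : Module.finrank (ZMod 2) F = e := by
    have := Module.card_eq_pow_finrank (K := ZMod 2) (V := F)
    rw [hF, ZMod.card] at this
    exact (Nat.pow_right_injective le_rfl this).symm
  have htr : ∀ x, Tr x = algebraMap (ZMod 2) F (Algebra.trace (ZMod 2) F x) := by
    intro x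
    rw [FiniteField.algebraMap_trace_eq_sum_pow, hrank, hTr, Nat.card_zmod]
  have h01 : ∀ x, Tr x = 0 ∨ Tr x = 1 := by
    intro x
    rw [htr]
    generalize Algebra.trace (ZMod 2) F x = t
    fin_cases t
    · left; exact map_zero _
    · right; exact map_one _
  have hadd : ∀ x y, Tr (x + y) = Tr x + Tr y := by
    intro x y
    rw [htr, htr, htr, map_add, map_add]
  have hsq : ∀ x, Tr (x ^ 2) = Tr x := by
    intro x
    have : Tr (x ^ 2) = Tr x ^ 2 := by
      rw [hTr, hTr, sum_pow_char]
      exact sum_congr rfl fun i _ => by rw [← pow_mul, ← pow_mul, mul_comm]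
    rw [this]
    rcases h01 x with h | h <;> simp [h]
  have hzero : Tr 0 = 0 := by rw [htr, map_zero, map_zero]
  obtain ⟨ψ, hval⟩ : ∃ ψ : AddChar F ℤ, ∀ x, ψ x = if Tr x = 0 then 1 else -1 :=
    ⟨{  toFun := fun x => if Tr x = 0 then 1 else -1
        map_zero_eq_one' := by simp [hzero]
        map_add_eq_mul' := by
          intro x y
          rw [hadd]
          rcases h01 x with h | h <;> rcases h01 y with h' | h' <;>
            simp [h, h', CharTwo.add_self_eq_zero] }, fun x => rfl⟩
  refine ⟨ψ, AddChar.IsPrimitive.of_ne_one ?_, fun x => by rw [hval, hval, hsq], fun x => ?_⟩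
  · rintro rfl
    refine Algebra.trace_ne_zero (ZMod 2) F (LinearMap.ext fun x => ?_)
    have hx := hval x
    have : Tr x = 0 := by
      by_contra hne
      simp [hne] at hx
    rw [htr] at this
    simpa using this
  · rcases h01 x with h | h <;> simp [hval, h]

/-- A character sum over `F × F` whose argument is linear in the second coordinate. -/
theorem sum_prod_addChar {F : Type*} [Field F] [Fintype F] [DecidableEq F] {ψ : AddChar F ℤ}
    (hψ : ψ.IsPrimitive) (g : F → F) (v : F) :
    ∑ p : F × F, ψ (g p.1 + v * p.2)
      = (∑ x, ψ (g x)) * if v = 0 then (Fintype.card F : ℤ) else 0 := by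
  have := AddChar.sum_mulShift v hψ
  push_cast at this
  rw [← this, sum_mul_sum, Fintype.sum_prod_type]
  exact sum_congr rfl fun x _ => sum_congr rfl fun y _ => by
    rw [AddChar.map_add_eq_mul, mul_comm v]

/-- A nonzero linear form on `F × F` has vanishing character sum. -/
theorem sum_prod_addChar_linear {F : Type*} [Field F] [Fintype F] [DecidableEq F]
    {ψ : AddChar F ℤ} (hψ : ψ.IsPrimitive) {u v : F} (huv : (u, v) ≠ (0, 0)) :
    ∑ p : F × F, ψ (u * p.1 + v * p.2) = 0 := by
  rw [sum_prod_addChar hψ (fun x => u * x)]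
  by_cases hv : v = 0
  · have hu : u ≠ 0 := fun hu => huv (by rw [hu, hv])
    have := AddChar.sum_mulShift u hψ
    simp_rw [mul_comm _ u] at this
    simp [this, hu]
  · simp [hv]

/-- If a function takes only the values `r` and `-r` with `r = 2 * M ≠ 0`, has total sum `r ^ 2`
and its domain has `r ^ 2` elements, then the value multiplicities are determined. -/
theorem card_fibers_of_sum_eq_sq {α : Type*} [Fintype α] {S : α → ℤ} {M : ℤ} (hM : M ≠ 0)
    (hS : ∀ x, S x = 2 * M ∨ S x = -(2 * M)) (hcard : (Fintype.card α : ℤ) = (2 * M) ^ 2)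
    (hsum : ∑ x, S x = (2 * M) ^ 2) :
    ((univ.filter fun x => S x = 2 * M).card : ℤ) = 2 * M ^ 2 + M ∧
      ((univ.filter fun x => S x = -(2 * M)).card : ℤ) = 2 * M ^ 2 - M := by
  classical
  have hne : ∀ x, (¬ S x = 2 * M) ↔ S x = -(2 * M) := by
    intro x
    rcases hS x with h | h <;> constructor <;> intro h' <;> first | exact h | omega
  have h1 := card_filter_add_card_filter_not (s := (univ : Finset α)) (fun x => S x = 2 * M)
  have h2 := sum_filter_add_sum_filter_not (univ : Finset α) (fun x => S x = 2 * M) S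
  simp only [hne] at h1 h2
  rw [sum_congr rfl fun x hx => (mem_filter.1 hx).2,
    sum_congr (s₁ := univ.filter fun x => S x = -(2 * M)) rfl fun x hx => (mem_filter.1 hx).2,
    sum_const, sum_const, hsum, nsmul_eq_mul, nsmul_eq_mul] at h2
  rw [card_univ] at h1
  zify at h1
  rw [hcard] at h1
  generalize ((univ.filter fun x => S x = 2 * M).card : ℤ) = P at *
  generalize ((univ.filter fun x => S x = -(2 * M)).card : ℤ) = N at *
  have h3 : P - N = 2 * M := mul_left_cancel₀ (mul_ne_zero two_ne_zero hM) (by linarith)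
  constructor <;> linarith

/-- Theorem 3(i): `e/h` even, `e = 2m`, `b ≠ 0`, `a` not a `(2^h+1)`-th power. Then
`|D_{(a,b)}| = q²/2 − 1` and the weight distribution is:
`q² − q − 1` codewords of weight `q²/4`, `q/2 + 2^{m−1}` of weight `(q/4)(q − 2^m)`,
and `q/2 − 2^{m−1}` of weight `(q/4)(q + 2^m)`; no other nonzero weights occur. -/
theorem stmt_11
    (e h m : ℕ) (hdvd : h ∣ e) (hh0 : 0 < h) (hhe : h < e)
    (heven : Even (e / h)) (hm : e = 2 * m)
    (F : Type) [Field F] [Fintype F] [DecidableEq F]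
    (hF : Fintype.card F = 2 ^ e)
    (q : ℤ) (hq : q = 2 ^ e)
    (Tr : F → F) (hTr : ∀ x, Tr x = ∑ i ∈ Finset.range e, x ^ 2 ^ i)
    (a b : F) (ha : a ≠ 0) (hb : b ≠ 0)
    (ha' : ∀ c : F, c ≠ 0 → a ≠ c ^ (2 ^ h + 1))
    (D : Finset (F × F))
    (hD : D = Finset.univ.filter fun p : F × F =>
        p ≠ (0, 0) ∧ Tr (a * p.1 ^ (2 ^ h + 1) + b * p.2) = 0)
    (wt : F × F → ℕ)
    (hwt : ∀ u v : F, wt (u, v) =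
        (D.filter fun p => Tr (u * p.1 + v * p.2) = 1).card) :
    ((D.card : ℤ) = q ^ 2 / 2 - 1) ∧
    (((Finset.univ.filter fun uv : F × F =>
        uv ≠ (0, 0) ∧ (wt uv : ℤ) = q ^ 2 / 4).card : ℤ)
      = q ^ 2 - q - 1) ∧
    (((Finset.univ.filter fun uv : F × F =>
        uv ≠ (0, 0) ∧ (wt uv : ℤ) = q / 4 * (q - 2 ^ m)).card : ℤ)
      = q / 2 + 2 ^ (m - 1)) ∧
    (((Finset.univ.filter fun uv : F × F =>
        uv ≠ (0, 0) ∧ (wt uv : ℤ) = q / 4 * (q + 2 ^ m)).card : ℤ)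
      = q / 2 - 2 ^ (m - 1)) ∧
    (∀ uv : F × F, uv ≠ (0, 0) →
      (wt uv : ℤ) = q ^ 2 / 4 ∨
      (wt uv : ℤ) = q / 4 * (q - 2 ^ m) ∨
      (wt uv : ℤ) = q / 4 * (q + 2 ^ m)) := by
  have hh2 : 2 * h ∣ e := by
    obtain ⟨k, hk⟩ := hdvd
    rw [hk, Nat.mul_div_cancel_left _ hh0] at heven
    obtain ⟨j, rfl⟩ := heven
    exact ⟨j, by rw [hk]; ring⟩
  have hchar : CharP F 2 := by
    have : Fact (Nat.Prime 2) := ⟨Nat.prime_two⟩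
    exact charP_of_card_eq_prime_pow hF
  obtain ⟨ψ, hψ, hfrob, hval⟩ := exists_addChar_trace hF hTr
  have hm1 : 1 ≤ m := by omega
  obtain ⟨M, hM⟩ : ∃ M : ℤ, M = 2 ^ (m - 1) := ⟨_, rfl⟩
  have hMpos : 0 < M := by rw [hM]; positivity
  have h2M : (2 : ℤ) ^ m = 2 * M := by
    rw [hM, ← pow_succ', Nat.sub_add_cancel hm1]
  have hqM : q = (2 * M) ^ 2 := by rw [hq, hm, ← h2M, ← pow_mul, mul_comm]
  have hcard : (Fintype.card F : ℤ) = q := by rw [hF, hq]; norm_cast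
  set S : F → ℤ := fun u => ∑ x, ψ (a * x ^ (2 ^ h + 1) + u * x) with hSdef
  have hS : ∀ u, S u = 2 * M ∨ S u = -(2 * M) := by
    intro u
    rw [← sq_eq_sq_iff_eq_or_eq_neg, ← hqM, ← hcard]
    exact sq_sum_gold hψ hfrob
      (fun z hz => linearized_ne_zero hh0 hh2 hF ha ha' hz) u
  have hSsum : ∑ u, S u = q := by
    rw [hSdef, sum_comm, sum_eq_single 0]
    · simp [hcard]
    · intro x _ hx
      simp_rw [AddChar.map_add_eq_mul, ← mul_sum]
      rw [AddChar.sum_mulShift x hψ, if_neg hx, Nat.cast_zero, mul_zero]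
    · simp
  obtain ⟨hP, hN⟩ := card_fibers_of_sum_eq_sq hMpos.ne' hS (by rw [hcard, hqM]) (by rw [hSsum, hqM])
  have hTr0 : Tr 0 = 0 := by simpa using hval 0
  have hsumD : ∑ p : F × F, ψ (a * p.1 ^ (2 ^ h + 1) + b * p.2) = 0 := by
    rw [sum_prod_addChar hψ (fun x => a * x ^ (2 ^ h + 1)), if_neg hb, mul_zero]
  have hcard2 : ∑ _p : F × F, (1 : ℤ) = q ^ 2 := by
    simp [← hcard, sq]
  have hDcard : 2 * ((D.card : ℤ) + 1) = q ^ 2 := by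
    have h0 : (0, 0) ∉ D := by simp [hD]
    have h1 : insert (0, 0) D = univ.filter fun p : F × F =>
        Tr (a * p.1 ^ (2 ^ h + 1) + b * p.2) = 0 := by
      ext p
      by_cases hp : p = (0, 0) <;> simp [hD, hp, hTr0]
    have h2 : (D.card : ℤ) + 1 = ((insert (0, 0) D).card : ℤ) := by
      rw [card_insert_of_notMem h0]; push_cast; rfl
    rw [h2, h1, card_filter]
    push_cast
    have h3 : ∀ p : F × F, 2 * (if Tr (a * p.1 ^ (2 ^ h + 1) + b * p.2) = 0 then (1 : ℤ) else 0)
        = 1 + ψ (a * p.1 ^ (2 ^ h + 1) + b * p.2) := by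
      intro p
      rcases hval (a * p.1 ^ (2 ^ h + 1) + b * p.2) with ⟨h, h'⟩ | ⟨h, h'⟩ <;> simp [h, h']
    rw [mul_sum, sum_congr rfl fun p _ => h3 p, sum_add_distrib, hsumD, hcard2, add_zero]
  have hwt4 : ∀ u v : F, (u, v) ≠ (0, 0) →
      4 * (wt (u, v) : ℤ) = q ^ 2 - if v = b then q * S u else 0 := by
    intro u v huv
    have h1 : (D.filter fun p => Tr (u * p.1 + v * p.2) = 1) = univ.filter fun p : F × F =>
        Tr (a * p.1 ^ (2 ^ h + 1) + b * p.2) = 0 ∧ Tr (u * p.1 + v * p.2) = 1 := by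
      ext p
      by_cases hp : p = (0, 0) <;> simp [hD, hp, hTr0]
    have h2 : ∑ p : F × F, ψ (a * p.1 ^ (2 ^ h + 1) + b * p.2 + (u * p.1 + v * p.2))
        = if v = b then q * S u else 0 := by
      have h3 := sum_prod_addChar hψ (fun x => a * x ^ (2 ^ h + 1) + u * x) (b + v)
      have h4 : b + v = 0 ↔ v = b := by
        rw [CharTwo.add_eq_zero, eq_comm]
      simp only [h4, hcard] at h3
      rw [mul_ite, mul_zero, mul_comm] at h3
      rw [← h3]
      refine sum_congr rfl fun p _ => ?_
      congr 1
      ring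
    rw [hwt, h1, card_filter]
    push_cast
    have h3 : ∀ p : F × F, 4 * (if Tr (a * p.1 ^ (2 ^ h + 1) + b * p.2) = 0 ∧
          Tr (u * p.1 + v * p.2) = 1 then (1 : ℤ) else 0)
        = 1 + ψ (a * p.1 ^ (2 ^ h + 1) + b * p.2) - ψ (u * p.1 + v * p.2)
          - ψ (a * p.1 ^ (2 ^ h + 1) + b * p.2 + (u * p.1 + v * p.2)) := by
      intro p
      rw [AddChar.map_add_eq_mul ψ (a * p.1 ^ (2 ^ h + 1) + b * p.2)]
      rcases hval (a * p.1 ^ (2 ^ h + 1) + b * p.2) with ⟨h, h'⟩ | ⟨h, h'⟩ <;>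
        rcases hval (u * p.1 + v * p.2) with ⟨k, k'⟩ | ⟨k, k'⟩ <;> simp [h, h', k, k']
    rw [mul_sum, sum_congr rfl fun p _ => h3 p, sum_sub_distrib, sum_sub_distrib,
      sum_add_distrib, hsumD, hcard2, sum_prod_addChar_linear hψ huv, h2, add_zero, sub_zero]
  have hq2 : q ^ 2 / 2 = 8 * M ^ 4 := by
    rw [hqM]; exact Int.ediv_eq_of_eq_mul_right two_ne_zero (by ring)
  have hq24 : q ^ 2 / 4 = 4 * M ^ 4 := by
    rw [hqM]; exact Int.ediv_eq_of_eq_mul_right four_ne_zero (by ring)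
  have hqd2 : q / 2 = 2 * M ^ 2 := by
    rw [hqM]; exact Int.ediv_eq_of_eq_mul_right two_ne_zero (by ring)
  have hqd4 : q / 4 = M ^ 2 := by
    rw [hqM]; exact Int.ediv_eq_of_eq_mul_right four_ne_zero (by ring)
  have hM3 : 0 < M ^ 3 := by positivity
  have hwtne : ∀ u v : F, (u, v) ≠ (0, 0) → v ≠ b → (wt (u, v) : ℤ) = 4 * M ^ 4 := by
    intro u v huv hv
    have := hwt4 u v huv
    rw [if_neg hv, hqM] at this
    linarith
  have hwtb : ∀ u : F, S u = 2 * M ∧ (wt (u, b) : ℤ) = 4 * M ^ 4 - 2 * M ^ 3 ∨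
      S u = -(2 * M) ∧ (wt (u, b) : ℤ) = 4 * M ^ 4 + 2 * M ^ 3 := by
    intro u
    have := hwt4 u b (by simp [hb])
    rw [if_pos rfl, hqM] at this
    rcases hS u with h | h <;> rw [h] at this
    · left; exact ⟨h, by linarith⟩
    · right; exact ⟨h, by linarith⟩
  have hlow : q / 4 * (q - 2 ^ m) = 4 * M ^ 4 - 2 * M ^ 3 := by rw [hqd4, h2M, hqM]; ring
  have hhigh : q / 4 * (q + 2 ^ m) = 4 * M ^ 4 + 2 * M ^ 3 := by rw [hqd4, h2M, hqM]; ring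
  rw [hlow, hhigh, hq2, hq24, hqd2, ← hM]
  refine ⟨?_, ?_, ?_, ?_, ?_⟩
  · rw [hqM] at hDcard
    linarith
  · have hset : (univ.filter fun uv : F × F => uv ≠ (0, 0) ∧ (wt uv : ℤ) = 4 * M ^ 4)
        = (univ ×ˢ (univ.erase b)).erase (0, 0) := by
      ext ⟨u, v⟩
      rw [mem_filter, mem_erase, mem_product, mem_erase]
      by_cases huv : (u, v) = (0, 0)
      · simp [huv]
      · by_cases hv : v = b
        · subst hv
          have : (wt (u, v) : ℤ) ≠ 4 * M ^ 4 := by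
            rcases hwtb u with ⟨-, h⟩ | ⟨-, h⟩ <;> rw [h] <;> intro h' <;> linarith
          simp [this]
        · simp [huv, hv, hwtne u v huv hv]
    have hqpos : 1 ≤ Fintype.card F := Fintype.card_pos
    rw [hset, card_erase_of_mem (by simp [hb.symm]), card_product, card_erase_of_mem (mem_univ _),
      card_univ]
    have h2le : 2 ≤ Fintype.card F := Fintype.one_lt_card
    have hmul : 1 ≤ Fintype.card F * (Fintype.card F - 1) :=
      Nat.mul_pos hqpos (Nat.sub_pos_of_lt h2le)
    rw [Nat.cast_sub hmul, Nat.cast_mul, Nat.cast_sub hqpos, hcard]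
    push_cast
    ring
  · have hset : (univ.filter fun uv : F × F =>
        uv ≠ (0, 0) ∧ (wt uv : ℤ) = 4 * M ^ 4 - 2 * M ^ 3)
        = (univ.filter fun u => S u = 2 * M) ×ˢ {b} := by
      ext ⟨u, v⟩
      rw [mem_filter, mem_product, mem_filter, mem_singleton]
      by_cases hv : v = b
      · subst hv
        rcases hwtb u with ⟨h, h'⟩ | ⟨h, h'⟩
        · simp [h, h', hb]
        · have h1 : ¬ (4 * M ^ 4 + 2 * M ^ 3 = 4 * M ^ 4 - 2 * M ^ 3) := by
            intro h; linarith
          have h2 : ¬ (-(2 * M) = 2 * M) := by intro h; linarith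
          simp only [h, h', h1, h2, and_false, false_and]
      · have hne : ¬ ((u, v) ≠ (0, 0) ∧ (wt (u, v) : ℤ) = 4 * M ^ 4 - 2 * M ^ 3) := by
          rintro ⟨huv, h⟩
          rw [hwtne u v huv hv] at h
          linarith
        simp only [hne, hv, and_false]
    rw [hset, card_product, card_singleton, mul_one, hP]
  · have hset : (univ.filter fun uv : F × F =>
        uv ≠ (0, 0) ∧ (wt uv : ℤ) = 4 * M ^ 4 + 2 * M ^ 3)
        = (univ.filter fun u => S u = -(2 * M)) ×ˢ {b} := by
      ext ⟨u, v⟩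
      rw [mem_filter, mem_product, mem_filter, mem_singleton]
      by_cases hv : v = b
      · subst hv
        rcases hwtb u with ⟨h, h'⟩ | ⟨h, h'⟩
        · have h1 : ¬ (4 * M ^ 4 - 2 * M ^ 3 = 4 * M ^ 4 + 2 * M ^ 3) := by
            intro h; linarith
          have h2 : ¬ (2 * M = -(2 * M)) := by intro h; linarith
          simp only [h, h', h1, h2, and_false, false_and]
        · simp [h, h', hb]
      · have hne : ¬ ((u, v) ≠ (0, 0) ∧ (wt (u, v) : ℤ) = 4 * M ^ 4 + 2 * M ^ 3) := by
          rintro ⟨huv, h⟩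
          rw [hwtne u v huv hv] at h
          linarith
        simp only [hne, hv, and_false]
    rw [hset, card_product, card_singleton, mul_one, hN]
  · rintro ⟨u, v⟩ huv
    by_cases hv : v = b
    · subst hv
      rcases hwtb u with ⟨-, h⟩ | ⟨-, h⟩
      · exact Or.inr (Or.inl h)
      · exact Or.inr (Or.inr h)
    · exact Or.inl (hwtne u v huv hv)
end
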